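/- arXiv:1806.03475 — 3 statements merged into one kernel-verified Lean document; each statement's English description precedes it below -/
import Mathlib

section
/- Let A be an n×n real matrix with p distinct (complex) eigenvalues λ_1,…,λ_p, where λ_i has geometric multiplicity k_i and left eigenbasis X_i, and let B̄ ⊆ {1,…,n}×{1,…,l} be a sparsity pattern. Then there exists a real n×l matrix B conforming to B̄ such that (A,B) is controllable if and only if for every i ∈ {1,…,p} there exist distinct row indices j_1,…,j_{k_i} ∈ {1,…,n} with {j_1,…,j_{k_i}} ∈ H_i and distinct column indices c_1,…,c_{k_i} ∈ {1,…,l} such that (j_t, c_t) ∈ B̄ for every t = 1,…,k_i. -/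
open Matrix

noncomputable section

/-- The controllability matrix `[B, AB, A²B, …, A^{n-1}B]`, as an `n × (n·l)` matrix. -/
def ctrbMat {R : Type} [CommRing R] {n l : ℕ} (A : Matrix (Fin n) (Fin n) R)
    (B : Matrix (Fin n) (Fin l) R) : Matrix (Fin n) (Fin n × Fin l) R :=
  Matrix.of fun i jk => (A ^ (jk.1 : ℕ) * B) i jk.2

/-- `(A, B)` is controllable iff the controllability matrix has rank `n`. -/
def Controllable {R : Type} [CommRing R] {n l : ℕ} (A : Matrix (Fin n) (Fin n) R)
    (B : Matrix (Fin n) (Fin l) R) : Prop :=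
  (ctrbMat A B).rank = n

/-- The columns of a matrix, as vectors. -/
def matCols {R : Type} [CommRing R] {n k : ℕ} (X : Matrix (Fin n) (Fin k) R) :
    Fin k → (Fin n → R) := fun j i => X i j

/-- `X` is an `n × k` matrix whose columns are a basis of the λ-eigenspace of `Aᵀ`
(equivalently, its columns are `k` linearly independent left eigenvectors of `A`
for `μ`, spanning the whole left eigenspace; in particular `k` is the geometric
multiplicity of `μ`). -/
def IsLeftEigenbasis {n k : ℕ} (A : Matrix (Fin n) (Fin n) ℂ) (μ : ℂ)
    (X : Matrix (Fin n) (Fin k) ℂ) : Prop :=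
  LinearIndependent ℂ (matCols X) ∧
  (∀ j, A.transpose.mulVec (matCols X j) = μ • matCols X j) ∧
  (∀ v : Fin n → ℂ, A.transpose.mulVec v = μ • v →
      v ∈ Submodule.span ℂ (Set.range (matCols X)))

/-- The submatrix of `M` consisting of the columns indexed by `S`. -/
def colSub {R : Type} [CommRing R] {m n : ℕ} (M : Matrix (Fin m) (Fin n) R)
    (S : Finset (Fin n)) : Matrix (Fin m) {x // x ∈ S} R :=
  M.submatrix id (fun j => (j : Fin n))

/-- `H = {J ⊆ {1,…,n} : |J| = k and the k×k submatrix of Xᵀ formed by the columns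
indexed by J is invertible}` (invertibility of the square submatrix is expressed
as full rank `k`). -/
def Hset {n k : ℕ} (X : Matrix (Fin n) (Fin k) ℂ) : Set (Finset (Fin n)) :=
  {J | J.card = k ∧ (colSub X.transpose J).rank = k}

/-- The diagonal 0/1 matrix `I_S` selecting the states in `S`. -/
def diagSel {n : ℕ} (S : Finset (Fin n)) : Matrix (Fin n) (Fin n) ℝ :=
  Matrix.diagonal (fun j => if j ∈ S then (1 : ℝ) else 0)

/-- `‖B‖₀`, the number of nonzero entries of `B`. -/
def sparsity {n l : ℕ} (B : Matrix (Fin n) (Fin l) ℝ) : ℕ :=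
  (Finset.univ.filter fun jc : Fin n × Fin l => B jc.1 jc.2 ≠ 0).card

/-- The MACP optimum: the minimal cardinality of a set `S` of actuated states
such that `(A, I_S)` is controllable. -/
def MACPopt {n : ℕ} (A : Matrix (Fin n) (Fin n) ℝ) : ℕ :=
  sInf {m | ∃ S : Finset (Fin n), Controllable A (diagSel S) ∧ S.card = m}

/-- The `l`-MSCP optimum: the minimal number of nonzero entries of an `n × l`
real matrix `B` such that `(A, B)` is controllable. -/
def MSCPopt {n : ℕ} (A : Matrix (Fin n) (Fin n) ℝ) (l : ℕ) : ℕ :=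
  sInf {m | ∃ B : Matrix (Fin n) (Fin l) ℝ, Controllable A B ∧ sparsity B = m}

section RankLemmas

variable {K : Type*} [Field K]

theorem Matrix.rank_eq_card_iff_vecMul_eq_zero {m n : Type*} [Fintype m] [Fintype n]
    (M : Matrix m n K) :
    M.rank = Fintype.card m ↔ ∀ w : m → K, w ᵥ* M = 0 → w = 0 := by
  have h : M.rank = Fintype.card m ↔ LinearIndependent K M.row := by
    rw [linearIndependent_iff_card_eq_finrank_span, Set.finrank, ← rank_eq_finrank_span_row,
      eq_comm]
  rw [h, ← vecMul_injective_iff]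
  exact injective_iff_map_eq_zero M.vecMulLinear

/-- A matrix with independent rows has a nonvanishing maximal minor. -/
theorem Matrix.exists_det_submatrix_ne_zero {k : ℕ} {ι : Type*} [Fintype ι]
    (M : Matrix (Fin k) ι K) (h : ∀ w, w ᵥ* M = 0 → w = 0) :
    ∃ f : Fin k → ι, (M.submatrix id f).det ≠ 0 := by
  have hr : M.rank = k := by
    simpa using (rank_eq_card_iff_vecMul_eq_zero M).2 h
  rw [rank_eq_finrank_span_cols] at hr
  obtain ⟨g, hg, -, hli⟩ := Submodule.exists_fun_fin_finrank_span_eq K (Set.range M.col)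
  choose f hf using hg
  refine ⟨f ∘ Fin.cast hr.symm, ?_⟩
  have hcol : (M.submatrix id (f ∘ Fin.cast hr.symm)).col = g ∘ Fin.cast hr.symm := by
    funext t
    exact hf _
  have := hli.comp (Fin.cast hr.symm) (Fin.cast_injective _)
  rw [← hcol, linearIndependent_cols_iff_isUnit, isUnit_iff_isUnit_det] at this
  exact this.ne_zero

theorem Matrix.injective_of_det_submatrix_ne_zero {m n k : Type*} [Fintype k] [DecidableEq k]
    (M : Matrix m n K) (r : k → m) (f : k → n) (h : (M.submatrix r f).det ≠ 0) :
    Function.Injective f := by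
  intro a b hab
  by_contra hne
  exact h (det_zero_of_column_eq hne fun i => by simp [hab])

/-- A nonzero minor of a product comes from a nonzero term in its Cauchy–Binet expansion. -/
theorem Matrix.exists_prod_ne_zero_of_det_mul_ne_zero {k n : Type*} [Fintype k] [DecidableEq k]
    [Fintype n] (M : Matrix k n K) (N : Matrix n k K) (h : (M * N).det ≠ 0) :
    ∃ e : k → n, (∀ t, N (e t) t ≠ 0) ∧ (M.submatrix id e).det ≠ 0 := by
  classical
  have hdet : (M * N).det = ∑ e : k → n, (∏ t, N (e t) t) * (M.submatrix id e).det := by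
    simp only [det_apply', mul_apply, submatrix_apply, id, Finset.prod_univ_sum,
      Fintype.piFinset_univ, Finset.mul_sum, Finset.prod_mul_distrib]
    rw [Finset.sum_comm]
    refine Finset.sum_congr rfl fun e _ => Finset.sum_congr rfl fun σ _ => ?_
    ring
  rw [hdet] at h
  obtain ⟨e, -, he⟩ := Finset.exists_ne_zero_of_sum_ne_zero h
  refine ⟨e, fun t => ?_, right_ne_zero_of_mul he⟩
  exact Finset.prod_ne_zero_iff.1 (left_ne_zero_of_mul he) t (Finset.mem_univ t)

end RankLemmas

theorem Matrix.vecMul_pow_eq_zero_of_forall_lt {R : Type} [CommRing R] [Nontrivial R]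
    {n l : ℕ} (A : Matrix (Fin n) (Fin n) R) (B : Matrix (Fin n) (Fin l) R) (w : Fin n → R)
    (h : ∀ j : Fin n, w ᵥ* (A ^ (j : ℕ) * B) = 0) (m : ℕ) : w ᵥ* (A ^ m * B) = 0 := by
  rcases Nat.eq_zero_or_pos n with rfl | hn
  · simp [Subsingleton.elim w 0]
  have hdeg : (Polynomial.X ^ m %ₘ A.charpoly).natDegree < n := by
    have hd := charpoly_natDegree_eq_dim A
    rw [Fintype.card_fin] at hd
    have hlt := Polynomial.natDegree_modByMonic_lt (Polynomial.X ^ m) (charpoly_monic A) (by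
      intro h1
      rw [h1, Polynomial.natDegree_one] at hd
      omega)
    omega
  rw [pow_eq_aeval_mod_charpoly, Polynomial.aeval_eq_sum_range' hdeg, Matrix.sum_mul,
    vecMul_sum]
  refine Finset.sum_eq_zero fun j hj => ?_
  rw [smul_mul, vecMul_smul, h ⟨j, Finset.mem_range.1 hj⟩, smul_zero]

theorem controllable_iff_vecMul {n l : ℕ} {K : Type} [Field K] (A : Matrix (Fin n) (Fin n) K)
    (B : Matrix (Fin n) (Fin l) K) :
    Controllable A B ↔ ∀ w : Fin n → K, (∀ m : ℕ, w ᵥ* (A ^ m * B) = 0) → w = 0 := by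
  have h := rank_eq_card_iff_vecMul_eq_zero (ctrbMat A B)
  rw [Fintype.card_fin] at h
  rw [Controllable, h]
  refine forall_congr' fun w => imp_congr_left ?_
  constructor
  · intro hw m
    refine vecMul_pow_eq_zero_of_forall_lt A B w (fun j => ?_) m
    ext c
    exact congrFun hw (j, c)
  · intro hw
    ext ⟨j, c⟩
    exact congrFun (hw j) c

theorem Matrix.vecMul_pow_of_eigenvector {R : Type*} [CommRing R] {n : ℕ}
    {A : Matrix (Fin n) (Fin n) R} {v : Fin n → R} {a : R} (h : v ᵥ* A = a • v) (m : ℕ) :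
    v ᵥ* A ^ m = a ^ m • v := by
  induction m with
  | zero => simp
  | succ m ih => rw [pow_succ, ← vecMul_vecMul, ih, smul_vecMul, h, smul_smul, pow_succ]

theorem Complex.vecMul_map_ofReal_eq_zero_iff {m n : ℕ} (v : Fin m → ℂ)
    (M : Matrix (Fin m) (Fin n) ℝ) :
    v ᵥ* M.map Complex.ofReal = 0 ↔
      (fun j => (v j).re) ᵥ* M = 0 ∧ (fun j => (v j).im) ᵥ* M = 0 := by
  simp [funext_iff, vecMul, dotProduct, Complex.ext_iff, forall_and]

/-- The Popov–Belevitch–Hautus eigenvector test for a real pair. -/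
theorem controllable_iff_eigenvector_test {n l : ℕ} (A : Matrix (Fin n) (Fin n) ℝ)
    (B : Matrix (Fin n) (Fin l) ℝ) :
    Controllable A B ↔ ∀ (a : ℂ) (v : Fin n → ℂ), v ᵥ* A.map Complex.ofReal = a • v →
      v ᵥ* B.map Complex.ofReal = 0 → v = 0 := by
  have hpow : ∀ m : ℕ, (A ^ m * B).map Complex.ofReal =
      A.map Complex.ofReal ^ m * B.map Complex.ofReal := by
    intro m
    have h1 := Matrix.map_mul (f := Complex.ofRealHom) (L := A ^ m) (M := B)
    have h2 := map_pow (Complex.ofRealHom.mapMatrix (m := Fin n)) A m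
    simp only [RingHom.mapMatrix_apply] at h2
    rw [h2] at h1
    exact h1
  rw [controllable_iff_vecMul]
  constructor
  · intro h a v hv hB
    have key : ∀ m : ℕ, v ᵥ* (A ^ m * B).map Complex.ofReal = 0 := by
      intro m
      rw [hpow, ← vecMul_vecMul, vecMul_pow_of_eigenvector hv, smul_vecMul, hB, smul_zero]
    simp only [Complex.vecMul_map_ofReal_eq_zero_iff] at key
    have hre := h _ fun m => (key m).1
    have him := h _ fun m => (key m).2
    ext j
    exact Complex.ext (congrFun hre j) (congrFun him j)
  · intro h w hw
    by_contra hne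
    let W : Submodule ℂ (Fin n → ℂ) :=
      ⨅ m : ℕ, LinearMap.ker
        (A.map Complex.ofReal ^ m * B.map Complex.ofReal).vecMulLinear
    have memW : ∀ v, v ∈ W ↔
        ∀ m : ℕ, v ᵥ* (A.map Complex.ofReal ^ m * B.map Complex.ofReal) = 0 := by
      simp [W, Submodule.mem_iInf]
    have hinv : ∀ v ∈ W, (A.map Complex.ofReal).vecMulLinear v ∈ W := by
      intro v hv
      rw [memW] at hv ⊢
      intro m
      rw [vecMulLinear_apply, vecMul_vecMul, ← Matrix.mul_assoc, ← pow_succ']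
      exact hv _
    have hwW : (fun j => (w j : ℂ)) ∈ W := by
      rw [memW]
      intro m
      rw [← hpow, Complex.vecMul_map_ofReal_eq_zero_iff]
      refine ⟨by simpa using hw m, ?_⟩
      simp only [Complex.ofReal_im]
      exact zero_vecMul _
    have : Nontrivial W := by
      refine ⟨⟨_, hwW⟩, 0, fun h0 => hne ?_⟩
      ext j
      simpa using congrFun (congrArg Subtype.val h0) j
    obtain ⟨a, ha⟩ := Module.End.exists_eigenvalue
      ((A.map Complex.ofReal).vecMulLinear.restrict hinv)
    obtain ⟨v, hv⟩ := ha.exists_hasEigenvector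
    have hva := congrArg Subtype.val hv.apply_eq_smul
    refine hv.2 (Subtype.ext (h a v hva ?_))
    simpa using (memW v).1 v.2 0

theorem IsLeftEigenbasis.mulVec_eq_zero {n k : ℕ} {A : Matrix (Fin n) (Fin n) ℂ} {a : ℂ}
    {X : Matrix (Fin n) (Fin k) ℂ} (hX : IsLeftEigenbasis A a X) {c : Fin k → ℂ}
    (hc : X *ᵥ c = 0) : c = 0 := by
  have := mulVec_injective_iff.2 (show LinearIndependent ℂ X.col from hX.1)
  exact this (by simpa using hc)

theorem IsLeftEigenbasis.vecMul_mulVec {n k : ℕ} {A : Matrix (Fin n) (Fin n) ℂ} {a : ℂ}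
    {X : Matrix (Fin n) (Fin k) ℂ} (hX : IsLeftEigenbasis A a X) (c : Fin k → ℂ) :
    (X *ᵥ c) ᵥ* A = a • (X *ᵥ c) := by
  have h : Aᵀ * X = a • X := by
    ext i j
    exact congrFun (hX.2.1 j) i
  rw [← mulVec_transpose, mulVec_mulVec, h, smul_mulVec]

theorem IsLeftEigenbasis.exists_mulVec_eq {n k : ℕ} {A : Matrix (Fin n) (Fin n) ℂ} {a : ℂ}
    {X : Matrix (Fin n) (Fin k) ℂ} (hX : IsLeftEigenbasis A a X) {v : Fin n → ℂ}
    (hv : v ᵥ* A = a • v) : ∃ c, X *ᵥ c = v := by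
  have h := hX.2.2 v (by rw [mulVec_transpose, hv])
  have hr : Submodule.span ℂ (Set.range (matCols X)) = LinearMap.range X.mulVecLin :=
    (range_mulVecLin X).symm
  rw [hr] at h
  exact h

/-- Controllability in terms of the maximal minors of the products `Xᵢᵀ B`. -/
theorem controllable_iff_minors {n l p : ℕ} (A : Matrix (Fin n) (Fin n) ℝ)
    (μ : Fin p → ℂ) (hspec : spectrum ℂ (A.map Complex.ofReal) = Set.range μ)
    (k : Fin p → ℕ) (X : ∀ i, Matrix (Fin n) (Fin (k i)) ℂ)
    (hX : ∀ i, IsLeftEigenbasis (A.map Complex.ofReal) (μ i) (X i))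
    (B : Matrix (Fin n) (Fin l) ℝ) :
    Controllable A B ↔ ∀ i, ∃ f : Fin (k i) → Fin l,
      (((X i)ᵀ * B.map Complex.ofReal).submatrix id f).det ≠ 0 := by
  rw [controllable_iff_eigenvector_test]
  constructor
  · intro h i
    refine exists_det_submatrix_ne_zero _ fun c hc => (hX i).mulVec_eq_zero ?_
    refine h (μ i) _ ((hX i).vecMul_mulVec c) ?_
    rwa [← vecMul_transpose, vecMul_vecMul]
  · intro h a v hv hB
    by_contra hne
    have ha : a ∈ spectrum ℂ (A.map Complex.ofReal) := by
      rw [spectrum.mem_iff, isUnit_iff_isUnit_det, isUnit_iff_ne_zero, not_not,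
        ← exists_vecMul_eq_zero_iff]
      refine ⟨v, hne, ?_⟩
      rw [vecMul_sub, hv, Algebra.algebraMap_eq_smul_one, vecMul_smul, vecMul_one, sub_self]
    rw [hspec] at ha
    obtain ⟨i, rfl⟩ := ha
    obtain ⟨c, rfl⟩ := (hX i).exists_mulVec_eq hv
    obtain ⟨f, hf⟩ := h i
    refine hf (exists_vecMul_eq_zero_iff.1 ⟨c, ?_, ?_⟩)
    · rintro rfl
      simp at hne
    · rw [← vecMul_transpose, vecMul_vecMul] at hB
      ext t
      exact congrFun hB (f t)

theorem image_mem_Hset_iff {n k : ℕ} (X : Matrix (Fin n) (Fin k) ℂ) {e : Fin k → Fin n}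
    (he : Function.Injective e) :
    Finset.image e Finset.univ ∈ Hset X ↔ (Xᵀ.submatrix id e).det ≠ 0 := by
  have hcard : (Finset.image e Finset.univ).card = k := by
    rw [Finset.card_image_of_injective _ he, Finset.card_fin]
  let g : Fin k ≃ {x // x ∈ Finset.image e Finset.univ} :=
    Equiv.ofBijective (fun t => ⟨e t, Finset.mem_image_of_mem e (Finset.mem_univ t)⟩)
      ⟨fun a b hab => he (congrArg Subtype.val hab), by
        rintro ⟨x, hx⟩
        obtain ⟨t, -, rfl⟩ := Finset.mem_image.1 hx
        exact ⟨t, rfl⟩⟩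
  have hrank : (colSub Xᵀ (Finset.image e Finset.univ)).rank = (Xᵀ.submatrix id e).rank :=
    (rank_submatrix (colSub Xᵀ (Finset.image e Finset.univ)) (Equiv.refl _) g).symm
  have hfull := rank_eq_card_iff_vecMul_eq_zero (Xᵀ.submatrix id e)
  rw [Fintype.card_fin] at hfull
  rw [Hset, Set.mem_ofPred_eq, hrank, hfull, ne_eq, ← exists_vecMul_eq_zero_iff]
  simp only [hcard, true_and]
  push Not
  exact forall_congr' fun w => not_imp_not.symm

/-- Finitely many minors of products `Mᵢ B` that are individually nonzero for suitable `B`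
with a given pattern are simultaneously nonzero for some real `B` with that pattern. -/
theorem exists_real_matrix_minors_ne_zero {n l p : ℕ} (Bpat : Set (Fin n × Fin l))
    (k : Fin p → ℕ) (M : ∀ i, Matrix (Fin (k i)) (Fin n) ℂ) (f : ∀ i, Fin (k i) → Fin l)
    (h : ∀ i, ∃ B : Matrix (Fin n) (Fin l) ℂ, (∀ j c, (j, c) ∉ Bpat → B j c = 0) ∧
      ((M i * B).submatrix id (f i)).det ≠ 0) :
    ∃ B : Matrix (Fin n) (Fin l) ℝ, (∀ j c, (j, c) ∉ Bpat → B j c = 0) ∧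
      ∀ i, ((M i * B.map Complex.ofReal).submatrix id (f i)).det ≠ 0 := by
  classical
  let G : Matrix (Fin n) (Fin l) (MvPolynomial (Fin n × Fin l) ℂ) :=
    Matrix.of fun j c => if (j, c) ∈ Bpat then MvPolynomial.X (j, c) else 0
  let P : Fin p → MvPolynomial (Fin n × Fin l) ℂ := fun i =>
    (((M i).map (MvPolynomial.C (σ := Fin n × Fin l)) * G :
      Matrix (Fin (k i)) (Fin l) (MvPolynomial (Fin n × Fin l) ℂ)).submatrix id (f i)).det
  have hP : ∀ (i : Fin p) (x : Fin n × Fin l → ℂ) (B : Matrix (Fin n) (Fin l) ℂ),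
      (∀ j c, B j c = if (j, c) ∈ Bpat then x (j, c) else 0) →
      MvPolynomial.eval x (P i) = ((M i * B).submatrix id (f i)).det := by
    intro i x B hB
    rw [RingHom.map_det]
    congr 1
    ext s t
    simp only [RingHom.mapMatrix_apply, map_apply, submatrix_apply]
    simp only [mul_apply, map_apply, map_sum, map_mul, MvPolynomial.eval_C, G, of_apply,
      apply_ite (MvPolynomial.eval x), MvPolynomial.eval_X, map_zero, hB, id]
  have hne : ∏ i, P i ≠ 0 := by
    refine Finset.prod_ne_zero_iff.2 fun i _ h0 => ?_
    obtain ⟨B, hB, hdet⟩ := h i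
    refine hdet ?_
    rw [← hP i (fun q => B q.1 q.2) B, h0, map_zero]
    intro j c
    split_ifs with hjc
    · rfl
    · exact hB j c hjc
  have hinf : (Set.range Complex.ofReal).Infinite :=
    Set.infinite_range_of_injective Complex.ofReal_injective
  obtain ⟨x, hx, hx0⟩ : ∃ x ∈ Set.pi Set.univ fun _ : Fin n × Fin l => Set.range Complex.ofReal,
      MvPolynomial.eval x (∏ i, P i) ≠ 0 := by
    by_contra! hall
    refine hne (MvPolynomial.funext_set _ (fun _ => hinf) fun x hx => ?_)
    rw [hall x hx, map_zero]
  choose y hy using fun q => hx q (Set.mem_univ q)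
  refine ⟨Matrix.of fun j c => if (j, c) ∈ Bpat then y (j, c) else 0, ?_, fun i => ?_⟩
  · intro j c hjc
    simp [hjc]
  · rw [← hP i x]
    · rw [map_prod, Finset.prod_ne_zero_iff] at hx0
      exact hx0 i (Finset.mem_univ i)
    · intro j c
      simp only [map_apply, of_apply, ← hy]
      split_ifs <;> simp

/-- Placing ones at the positions `(e t, f t)` turns the corresponding minor of `M B`
into the minor of `M` on the columns `e`. -/
theorem Matrix.exists_mul_submatrix_eq {k m n l R : Type*} [Fintype n] [DecidableEq n]
    [NonAssocSemiring R] (M : Matrix m n R) (e : k → n) (f : k → l)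
    (hf : Function.Injective f) :
    ∃ B : Matrix n l R, (∀ j c, B j c ≠ 0 → ∃ t, e t = j ∧ f t = c) ∧
      (M * B).submatrix id f = M.submatrix id e := by
  classical
  refine ⟨Matrix.of fun j c => if ∃ t, e t = j ∧ f t = c then 1 else 0, ?_, ?_⟩
  · intro j c h
    by_contra hn
    simp [hn] at h
  · ext s t
    have : ∀ j, (∃ t', e t' = j ∧ f t' = f t) ↔ e t = j := fun j =>
      ⟨fun ⟨t', h1, h2⟩ => hf h2 ▸ h1, fun h => ⟨t, h, rfl⟩⟩
    simp [mul_apply, this]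

theorem statement_3 {n l p : ℕ} (A : Matrix (Fin n) (Fin n) ℝ)
    (μ : Fin p → ℂ) (hμ : Function.Injective μ)
    (hspec : spectrum ℂ (A.map Complex.ofReal) = Set.range μ)
    (k : Fin p → ℕ) (X : ∀ i, Matrix (Fin n) (Fin (k i)) ℂ)
    (hX : ∀ i, IsLeftEigenbasis (A.map Complex.ofReal) (μ i) (X i))
    (Bpat : Set (Fin n × Fin l)) :
    (∃ B : Matrix (Fin n) (Fin l) ℝ,
        (∀ j c, (j, c) ∉ Bpat → B j c = 0) ∧ Controllable A B) ↔
      ∀ i, ∃ (e : Fin (k i) → Fin n) (f : Fin (k i) → Fin l),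
        Function.Injective e ∧ Function.Injective f ∧
        Finset.image e Finset.univ ∈ Hset (X i) ∧
        ∀ t, (e t, f t) ∈ Bpat := by
  constructor
  · rintro ⟨B, hB, hctrb⟩ i
    obtain ⟨f, hf⟩ := (controllable_iff_minors A μ hspec k X hX B).1 hctrb i
    have hfinj := injective_of_det_submatrix_ne_zero _ _ _ hf
    obtain ⟨e, he, hdet⟩ := exists_prod_ne_zero_of_det_mul_ne_zero (X i)ᵀ
      ((B.map Complex.ofReal).submatrix id f) hf
    have heinj := injective_of_det_submatrix_ne_zero _ _ _ hdet
    refine ⟨e, f, heinj, hfinj, (image_mem_Hset_iff (X i) heinj).2 hdet, fun t => ?_⟩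
    by_contra hn
    exact he t (by simp [hB _ _ hn])
  · intro h
    choose e f he hf hH hpat using h
    obtain ⟨B, hB, hdet⟩ := exists_real_matrix_minors_ne_zero Bpat k (fun i => (X i)ᵀ) f (by
      intro i
      obtain ⟨B, hB, hsub⟩ := exists_mul_submatrix_eq (X i)ᵀ (e i) (f i) (hf i)
      refine ⟨B, fun j c hjc => ?_, ?_⟩
      · by_contra hne
        obtain ⟨t, rfl, rfl⟩ := hB j c hne
        exact hjc (hpat i t)
      · rw [hsub]
        exact (image_mem_Hset_iff (X i) (he i)).1 (hH i))
    exact ⟨B, hB, (controllable_iff_minors A μ hspec k X hX B).2 fun i => ⟨f i, hdet i⟩⟩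
end
end

section
/- Let A be an n×n real matrix with p distinct (complex) eigenvalues λ_1,…,λ_p, where λ_i has geometric multiplicity k_i and left eigenbasis X_i. For S ⊆ {1,…,n}, let I_S be the n×n diagonal matrix with (I_S)_{jj} = 1 if j ∈ S and 0 otherwise. Then (A, I_S) is controllable if and only if for every i ∈ {1,…,p}, the submatrix of X_iᵀ consisting of the columns indexed by S has rank k_i. -/
open Matrix

noncomputable section

theorem rank_eq_card_iff_vecMul_injective {K m n : Type*} [Field K] [Fintype m] [Fintype n]
    (M : Matrix m n K) :
    M.rank = Fintype.card m ↔ ∀ v : m → K, v ᵥ* M = 0 → v = 0 := by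
  rw [rank_eq_finrank_span_row, eq_comm, ← Set.finrank, ← linearIndependent_iff_card_eq_finrank_span,
    ← vecMul_injective_iff]
  exact injective_iff_map_eq_zero M.vecMulLinear

/-- Left kernels of a real matrix over the reals and over the complex numbers vanish together. -/
theorem vecMul_injective_map_ofReal_iff {m n : Type*} [Fintype m] (M : Matrix m n ℝ) :
    (∀ v : m → ℝ, v ᵥ* M = 0 → v = 0) ↔
      ∀ v : m → ℂ, v ᵥ* M.map Complex.ofReal = 0 → v = 0 := by
  constructor
  · intro h v hv
    have hre : (fun i => (v i).re) = 0 := h _ <| by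
      ext j
      simpa [vecMul, dotProduct] using congrArg Complex.re (congrFun hv j)
    have him : (fun i => (v i).im) = 0 := h _ <| by
      ext j
      simpa [vecMul, dotProduct] using congrArg Complex.im (congrFun hv j)
    ext i
    exact Complex.ext (congrFun hre i) (congrFun him i)
  · intro h v hv
    have hc : (fun i => (v i : ℂ)) = 0 := h _ <| by
      ext j
      have := congrArg Complex.ofReal (congrFun hv j)
      simpa [vecMul, dotProduct] using this
    ext i
    exact Complex.ofReal_injective (congrFun hc i)

theorem vecMul_ctrbMat_diagSel_map_eq_zero_iff {n : ℕ} (A : Matrix (Fin n) (Fin n) ℝ)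
    (S : Finset (Fin n)) (v : Fin n → ℂ) :
    v ᵥ* (ctrbMat A (diagSel S)).map Complex.ofReal = 0 ↔
      ∀ j < n, ∀ s ∈ S, (v ᵥ* A.map Complex.ofReal ^ j) s = 0 := by
  have key (j : Fin n) (s : Fin n) :
      (v ᵥ* (ctrbMat A (diagSel S)).map Complex.ofReal) (j, s) =
        if s ∈ S then (v ᵥ* A.map Complex.ofReal ^ (j : ℕ)) s else 0 := by
    have hpow : A.map Complex.ofReal ^ (j : ℕ) = (A ^ (j : ℕ)).map Complex.ofReal :=
      (map_pow Complex.ofRealHom.mapMatrix A j).symm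
    rw [hpow]
    split_ifs with hs <;> simp [vecMul, dotProduct, ctrbMat, diagSel, hs]
  constructor
  · intro h j hj s hs
    have := key ⟨j, hj⟩ s
    rwa [h, if_pos hs, eq_comm] at this
  · intro h
    ext ⟨j, s⟩
    rw [key]
    split_ifs with hs
    · exact h j j.2 s hs
    · rfl

/-- By Cayley–Hamilton, the vanishing of `v A^j` at a coordinate for all `j < n` propagates to
all powers. -/
theorem vecMul_pow_apply_eq_zero {K : Type*} [Field K] {n : ℕ} (A : Matrix (Fin n) (Fin n) K)
    (v : Fin n → K) (s : Fin n) (h : ∀ j < n, (v ᵥ* A ^ j) s = 0) (j : ℕ) :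
    (v ᵥ* A ^ j) s = 0 := by
  have : NeZero n := ⟨(Fin.pos s).ne'⟩
  have hdeg : (Polynomial.X ^ j %ₘ A.charpoly).natDegree < n := by
    have := Polynomial.natDegree_modByMonic_lt (Polynomial.X ^ j) A.charpoly_monic fun h1 => by
      have := A.charpoly_natDegree_eq_dim
      simp [h1, NeZero.ne' n] at this
    simpa [A.charpoly_natDegree_eq_dim] using this
  rw [pow_eq_aeval_mod_charpoly, Polynomial.aeval_eq_sum_range' hdeg, vecMul_sum,
    Finset.sum_apply]
  refine Finset.sum_eq_zero fun i hi => ?_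
  rw [vecMul_smul, Pi.smul_apply, h i (Finset.mem_range.1 hi), smul_zero]

/-- If no left eigenvector of `A` vanishes on `S`, then no nonzero vector `v` has all `v A^j`
vanishing on `S`. -/
theorem eq_zero_of_vecMul_pow_eq_zero {K : Type*} [Field K] [IsAlgClosed K] {n : ℕ}
    (A : Matrix (Fin n) (Fin n) K) (S : Set (Fin n))
    (hA : ∀ (c : K) (v : Fin n → K), v ᵥ* A = c • v → (∀ s ∈ S, v s = 0) → v = 0)
    (v : Fin n → K) (hv : ∀ j, ∀ s ∈ S, (v ᵥ* A ^ j) s = 0) : v = 0 := by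
  let W : Submodule K (Fin n → K) :=
    { carrier := {w | ∀ j, ∀ s ∈ S, (w ᵥ* A ^ j) s = 0}
      add_mem' := fun ha hb j s hs => by simp [add_vecMul, ha j s hs, hb j s hs]
      zero_mem' := fun j s _ => by simp
      smul_mem' := fun c w hw j s hs => by simp [smul_vecMul, hw j s hs] }
  have hW : ∀ w ∈ W, A.vecMulLinear w ∈ W := fun w hw j s hs => by
    rw [vecMulLinear_apply, vecMul_vecMul, ← pow_succ']
    exact hw (j + 1) s hs
  by_contra hne
  have : Nontrivial W := ⟨⟨v, hv⟩, 0, fun h => hne (congrArg Subtype.val h)⟩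
  obtain ⟨c, hc⟩ := Module.End.exists_eigenvalue (A.vecMulLinear.restrict hW)
  obtain ⟨w, hw⟩ := hc.exists_hasEigenvector
  refine hw.2 (Subtype.ext (hA c w ?_ fun s hs => ?_))
  · exact congrArg Subtype.val hw.apply_eq_smul
  · simpa using w.2 0 s hs

theorem mem_spectrum_of_vecMul_eq_smul {K : Type*} [Field K] {n : ℕ}
    (A : Matrix (Fin n) (Fin n) K) (c : K) (v : Fin n → K) (hv : v ᵥ* A = c • v) (h0 : v ≠ 0) :
    c ∈ spectrum K A := by
  intro hu
  refine h0 (vecMul_injective_of_isUnit hu ?_)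
  simp [Algebra.algebraMap_eq_smul_one, vecMul_sub, vecMul_smul, hv]

theorem rank_colSub_transpose_eq_iff {n k : ℕ} {A : Matrix (Fin n) (Fin n) ℂ} {c : ℂ}
    {X : Matrix (Fin n) (Fin k) ℂ} (hX : IsLeftEigenbasis A c X) (S : Finset (Fin n)) :
    (colSub X.transpose S).rank = k ↔
      ∀ v : Fin n → ℂ, v ᵥ* A = c • v → (∀ s ∈ S, v s = 0) → v = 0 := by
  obtain ⟨hli, heig, hspan⟩ := hX
  have hcomb (w : Fin k → ℂ) : X *ᵥ w = ∑ j, w j • matCols X j := by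
    ext i
    simp [mulVec, dotProduct, matCols, mul_comm]
  have hsub (w : Fin k → ℂ) (s : {x // x ∈ S}) :
      (w ᵥ* colSub X.transpose S) s = (X *ᵥ w) s := by
    simp [mulVec, vecMul, dotProduct, colSub, mul_comm]
  have hrank := rank_eq_card_iff_vecMul_injective (colSub X.transpose S)
  rw [Fintype.card_fin] at hrank
  rw [hrank]
  constructor
  · intro h v hv hS
    obtain ⟨w, rfl⟩ := (Submodule.mem_span_range_iff_exists_fun ℂ).1
      (hspan v (by rwa [mulVec_transpose]))
    rw [← hcomb] at hS ⊢
    rw [h w (funext fun s => (hsub w s).trans (hS s s.2)), mulVec_zero]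
  · intro h w hw
    have hXw : X *ᵥ w = 0 := by
      refine h _ ?_ fun s hs => by rw [← hsub w ⟨s, hs⟩, hw, Pi.zero_apply]
      rw [← mulVec_transpose, hcomb, mulVec_sum, Finset.smul_sum]
      exact Finset.sum_congr rfl fun j _ => by rw [mulVec_smul, heig, smul_comm]
    rw [hcomb] at hXw
    exact funext (Fintype.linearIndependent_iff.1 hli w hXw)

/-- The **Popov–Belevitch–Hautus eigenvector test** for `(A, I_S)`. -/
theorem controllable_diagSel_iff {n : ℕ} (A : Matrix (Fin n) (Fin n) ℝ) (S : Finset (Fin n)) :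
    Controllable A (diagSel S) ↔ ∀ (c : ℂ) (v : Fin n → ℂ),
      v ᵥ* A.map Complex.ofReal = c • v → (∀ s ∈ S, v s = 0) → v = 0 := by
  have hrank := rank_eq_card_iff_vecMul_injective (ctrbMat A (diagSel S))
  rw [Fintype.card_fin, vecMul_injective_map_ofReal_iff] at hrank
  simp only [vecMul_ctrbMat_diagSel_map_eq_zero_iff] at hrank
  rw [Controllable, hrank]
  constructor
  · intro h c v hv hS
    have hpow (j : ℕ) : v ᵥ* A.map Complex.ofReal ^ j = c ^ j • v := by
      induction j with
      | zero => simp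
      | succ j ih => rw [pow_succ, ← vecMul_vecMul, ih, smul_vecMul, hv, smul_smul, pow_succ]
    exact h v fun j _ s hs => by simp [hpow, hS s hs]
  · intro h v hv
    exact eq_zero_of_vecMul_pow_eq_zero _ (S : Set (Fin n)) h v fun j s hs =>
      vecMul_pow_apply_eq_zero _ v s (fun i hi => hv i hi s hs) j

theorem statement_10 {n p : ℕ} (A : Matrix (Fin n) (Fin n) ℝ)
    (μ : Fin p → ℂ) (hμ : Function.Injective μ)
    (hspec : spectrum ℂ (A.map Complex.ofReal) = Set.range μ)
    (k : Fin p → ℕ) (X : ∀ i, Matrix (Fin n) (Fin (k i)) ℂ)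
    (hX : ∀ i, IsLeftEigenbasis (A.map Complex.ofReal) (μ i) (X i))
    (S : Finset (Fin n)) :
    Controllable A (diagSel S) ↔ ∀ i, (colSub (X i).transpose S).rank = k i := by
  rw [controllable_diagSel_iff]
  constructor
  · exact fun h i => (rank_colSub_transpose_eq_iff (hX i) S).2 (h (μ i))
  · intro h c v hv hS
    by_contra h0
    obtain ⟨i, rfl⟩ : c ∈ Set.range μ := hspec ▸ mem_spectrum_of_vecMul_eq_smul _ c v hv h0
    exact h0 ((rank_colSub_transpose_eq_iff (hX i) S).1 (h i) v hv hS)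
end
end

section
/- Let A be an n×n real matrix all of whose distinct (complex) eigenvalues have geometric multiplicity 1. Then for every l ≥ 1, the l-MSCP optimum of A equals the MACP optimum of A. -/
open Matrix

noncomputable section

/-- Controllability means that no nonzero row vector annihilates all the blocks `A ^ k * B`. -/
theorem controllable_iff_forall_vecMul_eq_zero {n l : ℕ} (A : Matrix (Fin n) (Fin n) ℝ)
    (B : Matrix (Fin n) (Fin l) ℝ) :
    Controllable A B ↔
      ∀ r : Fin n → ℝ, (∀ k < n, r ᵥ* (A ^ k * B) = 0) → r = 0 := by
  have hrank : Controllable A B ↔ LinearIndependent ℝ (ctrbMat A B).row := by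
    rw [linearIndependent_iff_card_eq_finrank_span, Controllable,
      Matrix.rank_eq_finrank_span_row, Fintype.card_fin, Set.finrank, eq_comm]
  have hentry : ∀ (r : Fin n → ℝ) (k : Fin n) (j : Fin l),
      (r ᵥ* ctrbMat A B) (k, j) = (r ᵥ* (A ^ (k : ℕ) * B)) j := fun r k j => rfl
  rw [hrank, ← Matrix.vecMul_injective_iff]
  change Function.Injective (Matrix.vecMulLinear (ctrbMat A B)) ↔ _
  rw [injective_iff_map_eq_zero]
  refine forall_congr' fun r => imp_congr_left ?_
  constructor
  · intro h k hk
    ext j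
    rw [← hentry r ⟨k, hk⟩ j]
    exact congrFun h _
  · intro h
    ext ⟨k, j⟩
    exact (hentry r k j).trans (congrFun (h k k.2) j)

/-- By Cayley–Hamilton, annihilating the first `n` blocks `A ^ k * B` means annihilating all. -/
theorem vecMul_pow_mul_eq_zero {R : Type*} [CommRing R] [Nontrivial R] {n l : ℕ}
    (A : Matrix (Fin n) (Fin n) R) (B : Matrix (Fin n) (Fin l) R) (r : Fin n → R)
    (h : ∀ k < n, r ᵥ* (A ^ k * B) = 0) (k : ℕ) : r ᵥ* (A ^ k * B) = 0 := by
  rcases Nat.eq_zero_or_pos n with rfl | hn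
  · rw [Subsingleton.elim r 0, Matrix.zero_vecMul]
  have hne : A.charpoly ≠ 1 := fun h1 => by
    have := A.charpoly_natDegree_eq_dim
    simp [h1] at this
    omega
  have hdeg : (Polynomial.X ^ k %ₘ A.charpoly).natDegree < n := by
    have := Polynomial.natDegree_modByMonic_lt (Polynomial.X ^ k) A.charpoly_monic hne
    simpa [A.charpoly_natDegree_eq_dim] using this
  rw [Matrix.pow_eq_aeval_mod_charpoly, Polynomial.aeval_eq_sum_range' hdeg, Matrix.sum_mul,
    Matrix.vecMul_sum]
  refine Finset.sum_eq_zero fun i hi => ?_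
  rw [Matrix.smul_mul, Matrix.vecMul_smul, h i (Finset.mem_range.mp hi), smul_zero]

/-- The Popov–Belevitch–Hautus test. -/
theorem controllable_iff_forall_left_eigenvector {n l : ℕ} (A : Matrix (Fin n) (Fin n) ℝ)
    (B : Matrix (Fin n) (Fin l) ℝ) :
    Controllable A B ↔
      ∀ (μ : ℂ) (w : Fin n → ℂ), w ≠ 0 → w ᵥ* A.map Complex.ofReal = μ • w →
        w ᵥ* B.map Complex.ofReal ≠ 0 := by
  have hmap : ∀ k : ℕ, (A ^ k * B).map Complex.ofReal =
      A.map Complex.ofReal ^ k * B.map Complex.ofReal := fun k => by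
    have hpow : (A ^ k).map Complex.ofReal = A.map Complex.ofReal ^ k :=
      Matrix.map_pow A Complex.ofRealHom k
    rw [← hpow]
    exact Matrix.map_mul (L := A ^ k) (M := B) (f := Complex.ofRealHom)
  rw [controllable_iff_forall_vecMul_eq_zero]
  constructor
  · intro h μ w hw hA hB
    have hpow : ∀ k : ℕ, w ᵥ* A.map Complex.ofReal ^ k = μ ^ k • w := by
      intro k
      induction k with
      | zero => simp
      | succ k ih =>
        rw [pow_succ, ← Matrix.vecMul_vecMul, ih, Matrix.smul_vecMul, hA, smul_smul, pow_succ]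
    have hzero : ∀ k : ℕ, w ᵥ* (A ^ k * B).map Complex.ofReal = 0 := fun k => by
      rw [hmap, ← Matrix.vecMul_vecMul, hpow, Matrix.smul_vecMul, hB, smul_zero]
    have hre : (fun i => (w i).re) = 0 := h _ fun k _ => by
      ext j
      have := congrArg Complex.re (congrFun (hzero k) j)
      simpa [Matrix.vecMul, dotProduct] using this
    have him : (fun i => (w i).im) = 0 := h _ fun k _ => by
      ext j
      have := congrArg Complex.im (congrFun (hzero k) j)
      simpa [Matrix.vecMul, dotProduct] using this
    exact hw (funext fun i => Complex.ext (congrFun hre i) (congrFun him i))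
  · intro h r hr
    by_contra hr0
    let f : Module.End ℂ (Fin n → ℂ) := Matrix.vecMulLinear (A.map Complex.ofReal)
    let V : Submodule ℂ (Fin n → ℂ) :=
      ⨅ k : ℕ, LinearMap.ker
        (Matrix.vecMulLinear (A.map Complex.ofReal ^ k * B.map Complex.ofReal))
    have hV : ∀ w, w ∈ V ↔
        ∀ k : ℕ, w ᵥ* (A.map Complex.ofReal ^ k * B.map Complex.ofReal) = 0 := fun w => by
      simp [V, Submodule.mem_iInf]
    have hinv : ∀ w ∈ V, f w ∈ V := fun w hw => by
      rw [hV] at hw ⊢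
      intro k
      change (w ᵥ* A.map Complex.ofReal) ᵥ* _ = 0
      rw [Matrix.vecMul_vecMul, ← Matrix.mul_assoc, ← pow_succ']
      exact hw (k + 1)
    have hrV : (fun i => (r i : ℂ)) ∈ V := by
      rw [hV]
      intro k
      rw [← hmap]
      ext j
      have := congrArg Complex.ofReal (congrFun (vecMul_pow_mul_eq_zero A B r hr k) j)
      simpa [Matrix.vecMul, dotProduct] using this
    have : Nontrivial V := ⟨⟨⟨_, hrV⟩, 0, fun h0 => hr0 (funext fun i => by
      simpa using congrFun (congrArg Subtype.val h0) i)⟩⟩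
    obtain ⟨μ, hμ⟩ := Module.End.exists_eigenvalue (f.restrict hinv)
    obtain ⟨v, hv⟩ := hμ.exists_hasEigenvector
    refine h μ v.1 (fun h0 => hv.2 (Subtype.ext h0)) (congrArg Subtype.val hv.apply_eq_smul) ?_
    simpa using (hV v.1).1 v.2 0

/-- A left eigenvector for `μ` witnesses that `μ` lies in the spectrum. -/
theorem mem_spectrum_of_vecMul_eq_smul_s15 {K : Type*} [Field K] {n : ℕ}
    {M : Matrix (Fin n) (Fin n) K} {μ : K} {w : Fin n → K} (hw : w ≠ 0) (h : w ᵥ* M = μ • w) :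
    μ ∈ spectrum K M := by
  rw [spectrum.mem_iff, Matrix.isUnit_iff_isUnit_det, isUnit_iff_ne_zero, not_not,
    ← Matrix.exists_vecMul_eq_zero_iff]
  refine ⟨w, hw, ?_⟩
  rw [Matrix.vecMul_sub, h, Algebra.algebraMap_eq_smul_one, Matrix.vecMul_smul, Matrix.vecMul_one,
    sub_self]

/-- If `μ` has geometric multiplicity one, its left eigenvectors are all proportional. -/
theorem exists_smul_eq_of_vecMul_eq_smul {K : Type*} [Field K] {n : ℕ}
    {M : Matrix (Fin n) (Fin n) K} {μ : K}
    (hμ : n - (μ • (1 : Matrix (Fin n) (Fin n) K) - M).rank = 1) {v w : Fin n → K}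
    (hv0 : v ≠ 0) (hv : v ᵥ* M = μ • v) (hw : w ᵥ* M = μ • w) : ∃ c : K, c • v = w := by
  set N := μ • (1 : Matrix (Fin n) (Fin n) K) - M
  have hmem : ∀ u : Fin n → K, u ᵥ* M = μ • u → u ∈ LinearMap.ker Nᵀ.mulVecLin := fun u hu => by
    rw [LinearMap.mem_ker, Matrix.mulVecLin_apply, Matrix.mulVec_transpose, Matrix.vecMul_sub, hu,
      Matrix.vecMul_smul, Matrix.vecMul_one, sub_self]
  have hfin : Module.finrank K (LinearMap.ker Nᵀ.mulVecLin) = 1 := by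
    have h1 := LinearMap.finrank_range_add_finrank_ker Nᵀ.mulVecLin
    have h2 : Module.finrank K (LinearMap.range Nᵀ.mulVecLin) = N.rank := N.rank_transpose
    rw [h2, Module.finrank_fin_fun] at h1
    omega
  obtain ⟨c, hc⟩ := (finrank_eq_one_iff_of_nonzero' (⟨v, hmem v hv⟩ : LinearMap.ker Nᵀ.mulVecLin)
    (fun h0 => hv0 (congrArg Subtype.val h0))).1 hfin ⟨w, hmem w hw⟩
  exact ⟨c, congrArg Subtype.val hc⟩

/-- Left multiplication by the complexified selector `I_S` restricts a row vector to `S`. -/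
theorem vecMul_map_diagSel {n : ℕ} (S : Finset (Fin n)) (w : Fin n → ℂ) (j : Fin n) :
    (w ᵥ* (diagSel S).map Complex.ofReal) j = if j ∈ S then w j else 0 := by
  rw [diagSel, Matrix.diagonal_map Complex.ofReal_zero, Matrix.vecMul_diagonal]
  split_ifs <;> simp

/-- If every eigenvalue has geometric multiplicity one, a set of actuated states making `A`
controllable supports a single real input vector meeting every left eigenvector. -/
theorem exists_input_vector {n : ℕ} (A : Matrix (Fin n) (Fin n) ℝ)
    (hgm : ∀ μ ∈ spectrum ℂ (A.map Complex.ofReal),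
      n - (μ • (1 : Matrix (Fin n) (Fin n) ℂ) - A.map Complex.ofReal).rank = 1)
    (S : Finset (Fin n)) (hS : Controllable A (diagSel S)) :
    ∃ b : Fin n → ℝ, (∀ j ∉ S, b j = 0) ∧ ∀ (μ : ℂ) (w : Fin n → ℂ), w ≠ 0 →
      w ᵥ* A.map Complex.ofReal = μ • w → ∑ j, w j * (b j : ℂ) ≠ 0 := by
  rw [controllable_iff_forall_left_eigenvector] at hS
  have hpoly : ∀ μ : ℂ, ∃ p : Polynomial ℂ, p ≠ 0 ∧ ∀ t : ℝ, p.eval (t : ℂ) ≠ 0 →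
      ∀ w : Fin n → ℂ, w ≠ 0 → w ᵥ* A.map Complex.ofReal = μ • w →
        ∑ j ∈ S, w j * (t : ℂ) ^ (j : ℕ) ≠ 0 := by
    intro μ
    by_cases hex : ∃ v : Fin n → ℂ, v ≠ 0 ∧ v ᵥ* A.map Complex.ofReal = μ • v
    · obtain ⟨v, hv0, hv⟩ := hex
      refine ⟨∑ j ∈ S, Polynomial.monomial (j : ℕ) (v j), fun hp => hS μ v hv0 hv ?_, ?_⟩
      · ext i
        rw [vecMul_map_diagSel]
        split_ifs with hi
        · have := congrArg (fun q => Polynomial.coeff q (i : ℕ)) hp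
          simpa [Polynomial.finsetSum_coeff, Polynomial.coeff_monomial, Fin.val_inj, hi] using this
        · rfl
      · intro t ht w hw0 hw
        obtain ⟨c, rfl⟩ := exists_smul_eq_of_vecMul_eq_smul
          (hgm μ (mem_spectrum_of_vecMul_eq_smul_s15 hv0 hv)) hv0 hv hw
        have hc : c ≠ 0 := by
          rintro rfl
          exact hw0 (zero_smul _ _)
        simp only [Pi.smul_apply, smul_eq_mul, mul_assoc, ← Finset.mul_sum]
        refine mul_ne_zero hc ?_
        simpa [Polynomial.eval_finsetSum, Polynomial.eval_monomial] using ht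
    · exact ⟨1, one_ne_zero, fun t _ w hw0 hw => (hex ⟨w, hw0, hw⟩).elim⟩
  choose p hp0 hp using hpoly
  have hfin : (spectrum ℂ (A.map Complex.ofReal)).Finite := Matrix.finite_spectrum _
  obtain ⟨t, ht⟩ : ∃ t : ℝ, (∏ μ ∈ hfin.toFinset, p μ).eval (t : ℂ) ≠ 0 := by
    by_contra! hall
    refine Finset.prod_ne_zero_iff.mpr (fun μ _ => hp0 μ)
      (Polynomial.eq_zero_of_infinite_isRoot (∏ μ ∈ hfin.toFinset, p μ) ?_)
    refine (Set.infinite_range_of_injective Complex.ofReal_injective).mono ?_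
    rintro _ ⟨t, rfl⟩
    exact hall t
  refine ⟨fun j => if j ∈ S then t ^ (j : ℕ) else 0, fun j hj => if_neg hj, ?_⟩
  intro μ w hw0 hw
  rw [Polynomial.eval_prod, Finset.prod_ne_zero_iff] at ht
  have hμ := ht μ (hfin.mem_toFinset.mpr (mem_spectrum_of_vecMul_eq_smul_s15 hw0 hw))
  simpa [apply_ite Complex.ofReal] using hp μ t hμ w hw0 hw

/-- A controllable `(A, I_S)` gives a controllable `(A, B)` with at most `|S|` nonzero entries in `B`. -/
theorem exists_controllable_sparsity_le {n : ℕ} (A : Matrix (Fin n) (Fin n) ℝ)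
    (hgm : ∀ μ ∈ spectrum ℂ (A.map Complex.ofReal),
      n - (μ • (1 : Matrix (Fin n) (Fin n) ℂ) - A.map Complex.ofReal).rank = 1)
    {l : ℕ} (hl : 1 ≤ l) (S : Finset (Fin n)) (hS : Controllable A (diagSel S)) :
    ∃ B : Matrix (Fin n) (Fin l) ℝ, Controllable A B ∧ sparsity B ≤ S.card := by
  obtain ⟨b, hbS, hb⟩ := exists_input_vector A hgm S hS
  let c₀ : Fin l := ⟨0, hl⟩
  refine ⟨Matrix.of fun j c => if c = c₀ then b j else 0, ?_, ?_⟩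
  · rw [controllable_iff_forall_left_eigenvector]
    intro μ w hw0 hw hB
    refine hb μ w hw0 hw ?_
    simpa [Matrix.vecMul, dotProduct] using congrFun hB c₀
  · refine Finset.card_le_card_of_injOn Prod.fst ?_ ?_
    · rintro ⟨j, c⟩ hjc
      by_contra hj
      simp [hbS j hj] at hjc
    · rintro ⟨j, c⟩ hjc ⟨j', c'⟩ hjc' h
      simp only [Finset.coe_filter, Finset.mem_univ, true_and, Set.mem_ofPred_eq, Matrix.of_apply,
        ne_eq, ite_eq_right_iff, Classical.not_imp] at hjc hjc'
      exact Prod.ext h (hjc.1.trans hjc'.1.symm)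

/-- The nonzero rows of a controllable `B` form a controllable set of actuated states. -/
theorem exists_controllable_diagSel {n l : ℕ} (A : Matrix (Fin n) (Fin n) ℝ)
    (B : Matrix (Fin n) (Fin l) ℝ) (hB : Controllable A B) :
    ∃ S : Finset (Fin n), Controllable A (diagSel S) ∧ S.card ≤ sparsity B := by
  refine ⟨(Finset.univ.filter fun jc : Fin n × Fin l => B jc.1 jc.2 ≠ 0).image Prod.fst, ?_,
    Finset.card_image_le⟩
  rw [controllable_iff_forall_left_eigenvector] at hB ⊢
  intro μ w hw0 hw hS
  refine hB μ w hw0 hw ?_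
  ext c
  change ∑ j, w j * (B j c : ℂ) = 0
  refine Finset.sum_eq_zero fun j _ => ?_
  by_cases hj : B j c = 0
  · simp [hj]
  · have hmem : j ∈ (Finset.univ.filter fun jc : Fin n × Fin l => B jc.1 jc.2 ≠ 0).image Prod.fst :=
      Finset.mem_image.mpr ⟨(j, c), by simpa using hj, rfl⟩
    have := congrFun hS j
    rw [vecMul_map_diagSel, if_pos hmem] at this
    simp [this]

/-- Actuating every state makes any system controllable. -/
theorem controllable_diagSel_univ {n : ℕ} (A : Matrix (Fin n) (Fin n) ℝ) :
    Controllable A (diagSel Finset.univ) := by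
  rw [controllable_iff_forall_left_eigenvector]
  intro μ w hw0 _ h
  refine hw0 (funext fun j => ?_)
  simpa [vecMul_map_diagSel] using congrFun h j

theorem statement_15 {n : ℕ} (A : Matrix (Fin n) (Fin n) ℝ)
    (hgm : ∀ μ ∈ spectrum ℂ (A.map Complex.ofReal),
      n - (μ • (1 : Matrix (Fin n) (Fin n) ℂ) - A.map Complex.ofReal).rank = 1) :
    ∀ l : ℕ, 1 ≤ l → MSCPopt A l = MACPopt A := by
  intro l hl
  obtain ⟨S, hS, hScard⟩ := Nat.sInf_mem
    (⟨_, _, controllable_diagSel_univ A, rfl⟩ :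
      {m | ∃ S : Finset (Fin n), Controllable A (diagSel S) ∧ S.card = m}.Nonempty)
  obtain ⟨B, hB, hBcard⟩ := exists_controllable_sparsity_le A hgm hl S hS
  obtain ⟨B', hB', hBcard'⟩ := Nat.sInf_mem
    (⟨_, B, hB, rfl⟩ :
      {m | ∃ B : Matrix (Fin n) (Fin l) ℝ, Controllable A B ∧ sparsity B = m}.Nonempty)
  obtain ⟨S', hS', hScard'⟩ := exists_controllable_diagSel A B' hB'
  refine le_antisymm ?_ ?_
  · have hle : MSCPopt A l ≤ sparsity B := Nat.sInf_le ⟨B, hB, rfl⟩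
    exact hle.trans (hBcard.trans hScard.le)
  · have hle : MACPopt A ≤ S'.card := Nat.sInf_le ⟨S', hS', rfl⟩
    exact hle.trans (hScard'.trans hBcard'.le)
end
end
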